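/- arXiv:1805.09919 — 2 statements merged into one kernel-verified Lean document; each statement's English description precedes it below -/
import Mathlib

section
/- (Proposition 1, necessity) Suppose there exists exactly one configuration conforming to the connector motif (n, m, d). Then for every port type p we have m p ≤ n p and n p * d p = m p * ∏_{q : P} C(n q, m q), where C denotes the binomial coefficient. -/
/-- A configuration `γ` (a finset of connectors) conforms to the connector motif `(n, m, d)`
if it is nonempty, every connector `k ∈ γ` has exactly `m p` instances of each port type `p`,
and every instance `i : Fin (n p)` of each port type `p` belongs to exactly `d p`
connectors of `γ`. -/
def Conforms {P : Type*} [Fintype P] [DecidableEq P] (n m d : P → ℕ)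
    (γ : Finset ((p : P) → Finset (Fin (n p)))) : Prop :=
  γ.Nonempty ∧
    (∀ k ∈ γ, ∀ p : P, (k p).card = m p) ∧
    (∀ (p : P) (i : Fin (n p)), (γ.filter fun k => i ∈ k p).card = d p)

/-- Finsets of equal cardinality in a finite type are related by a permutation. -/
theorem Finset.exists_perm_finsetCongr_eq {α : Type*} [Fintype α] [DecidableEq α]
    {s t : Finset α} (h : s.card = t.card) :
    ∃ σ : Equiv.Perm α, σ.finsetCongr s = t := by
  let e : {x // x ∈ s} ≃ {x // x ∈ t} := Finset.equivOfCardEq h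
  refine ⟨e.extendSubtype, ?_⟩
  rw [Equiv.finsetCongr_apply]
  refine Finset.eq_of_subset_of_card_le ?_ (by rw [Finset.card_map, h])
  intro x hx
  obtain ⟨y, hy, rfl⟩ := Finset.mem_map.1 hx
  exact e.extendSubtype_mem y hy

/-- Conformance is preserved by permuting the instances of each port type. -/
theorem Conforms.map_perm {P : Type*} [Fintype P] [DecidableEq P] {n m d : P → ℕ}
    {γ : Finset ((p : P) → Finset (Fin (n p)))} (h : Conforms n m d γ)
    (σ : (p : P) → Equiv.Perm (Fin (n p))) :
    Conforms n m d (γ.map (Equiv.piCongrRight fun p => (σ p).finsetCongr).toEmbedding) := by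
  obtain ⟨hne, hcard, hdeg⟩ := h
  refine ⟨hne.map, ?_, ?_⟩
  · intro k hk p
    obtain ⟨l, hl, rfl⟩ := Finset.mem_map.1 hk
    simpa using hcard l hl p
  · intro p i
    rw [Finset.filter_map, Finset.card_map, ← hdeg p ((σ p).symm i)]
    congr 1
    ext k
    simp [Finset.mem_map_equiv]

/-- A uniquely conforming configuration consists of all connectors of the right cardinalities. -/
theorem Conforms.eq_piFinset_powersetCard {P : Type*} [Fintype P] [DecidableEq P] {n m d : P → ℕ}
    {γ : Finset ((p : P) → Finset (Fin (n p)))} (h : Conforms n m d γ)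
    (huniq : ∀ γ', Conforms n m d γ' → γ' = γ) :
    γ = Fintype.piFinset fun p => Finset.powersetCard (m p) Finset.univ := by
  ext k
  simp only [Fintype.mem_piFinset, Finset.mem_powersetCard_univ]
  refine ⟨h.2.1 k, fun hk => ?_⟩
  obtain ⟨l, hl⟩ := h.1
  choose σ hσ using fun p =>
    Finset.exists_perm_finsetCongr_eq ((h.2.1 l hl p).trans (hk p).symm)
  rw [← huniq _ (h.map_perm σ)]
  exact Finset.mem_map.2 ⟨l, hl, funext hσ⟩

/-- Double counting of the incidences between instances and connectors. -/
theorem Conforms.mul_degree_eq {P : Type*} [Fintype P] [DecidableEq P] {n m d : P → ℕ}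
    {γ : Finset ((p : P) → Finset (Fin (n p)))} (h : Conforms n m d γ) (p : P) :
    n p * d p = m p * γ.card := by
  have key := Finset.card_mul_eq_card_mul (s := (Finset.univ : Finset (Fin (n p)))) (t := γ)
    (fun i (k : (p : P) → Finset (Fin (n p))) => i ∈ k p) (m := d p) (n := m p)
    (fun i _ => by simpa [Finset.bipartiteAbove] using h.2.2 p i)
    (fun k hk => by simpa [Finset.bipartiteBelow] using h.2.1 k hk p)
  simpa [mul_comm (m p)] using key

theorem stmt_11 {P : Type*} [Fintype P] [DecidableEq P] (n m d : P → ℕ)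
    (hm : ∀ p, 0 < m p)
    (h : ∃! γ : Finset ((p : P) → Finset (Fin (n p))), Conforms n m d γ) :
    ∀ p : P, m p ≤ n p ∧ n p * d p = m p * ∏ q : P, (n q).choose (m q) := by
  obtain ⟨γ, hγ, huniq⟩ := h
  intro p
  constructor
  · obtain ⟨k, hk⟩ := hγ.1
    simpa [hγ.2.1 k hk p] using (k p).card_le_univ
  · rw [hγ.mul_degree_eq p, hγ.eq_piFinset_powersetCard huniq]
    simp [Fintype.card_piFinset]
end

section
/- (Proposition 1, diagram version) Let a BIP architecture diagram be given by a finite index type L of connector motifs, where motif l has port-type set P l and parameter functions n l, m l, d l : P l → ℕ with (m l) p > 0 for all p. A conforming architecture is a family assigning to each l : L a configuration γ l conforming to the connector motif (n l, m l, d l). Then the diagram has exactly one conforming architecture if and only if for every motif l and every port type p : P l we have (m l) p ≤ (n l) p and (n l) p * (d l) p = (m l) p * ∏_{q : P l} C((n l) q, (m l) q), where C denotes the binomial coefficient. -/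
/-- The permutation of connectors induced by permuting the instances of each port type. -/
def connectorPerm {P : Type*} {n : P → ℕ} (φ : (p : P) → Equiv.Perm (Fin (n p))) :
    Equiv.Perm ((p : P) → Finset (Fin (n p))) :=
  Equiv.piCongrRight fun p => (φ p).finsetCongr

lemma connectorPerm_apply {P : Type*} {n : P → ℕ} (φ : (p : P) → Equiv.Perm (Fin (n p)))
    (k : (p : P) → Finset (Fin (n p))) (p : P) :
    connectorPerm φ k p = (k p).map (φ p).toEmbedding := rfl

lemma card_filter_map_connectorPerm {P : Type*} {n : P → ℕ}
    (φ : (p : P) → Equiv.Perm (Fin (n p))) (γ : Finset ((p : P) → Finset (Fin (n p))))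
    (p : P) (i : Fin (n p)) :
    ((γ.map (connectorPerm φ).toEmbedding).filter fun k => i ∈ k p).card =
      (γ.filter fun k => (φ p).symm i ∈ k p).card := by
  rw [Finset.filter_map, Finset.card_map]
  congr 1
  ext k
  simp [connectorPerm_apply, Finset.mem_map_equiv]

lemma exists_perm_map_eq {α : Type*} [Fintype α] [DecidableEq α] {s t : Finset α}
    (h : s.card = t.card) : ∃ φ : Equiv.Perm α, s.map φ.toEmbedding = t := by
  refine ⟨(Finset.equivOfCardEq h).extendSubtype, ?_⟩
  refine Finset.eq_of_subset_of_card_le (fun x hx => ?_) (by simp [h])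
  obtain ⟨y, hy, rfl⟩ := Finset.mem_map.1 hx
  exact (Finset.equivOfCardEq h).extendSubtype_mem y hy

lemma exists_connectorPerm_eq {P : Type*} {n : P → ℕ} {k k' : (p : P) → Finset (Fin (n p))}
    (h : ∀ p, (k p).card = (k' p).card) : ∃ φ, connectorPerm φ k = k' := by
  choose φ hφ using fun p => exists_perm_map_eq (h p)
  exact ⟨φ, funext hφ⟩

lemma sum_card_filter_mem {P : Type*} {n m : P → ℕ} {γ : Finset ((p : P) → Finset (Fin (n p)))}
    (h : ∀ k ∈ γ, ∀ p, (k p).card = m p) (p : P) :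
    ∑ i : Fin (n p), (γ.filter fun k => i ∈ k p).card = m p * γ.card := by
  simp_rw [Finset.card_filter]
  rw [Finset.sum_comm, mul_comm, ← smul_eq_mul, ← Finset.sum_const]
  refine Finset.sum_congr rfl fun k hk => ?_
  simp [h k hk p]

section

variable {P : Type*} [Fintype P] [DecidableEq P] {n m d : P → ℕ}

/-- All connectors having exactly `m p` instances of each port type `p`. -/
def allConnectors (n m : P → ℕ) : Finset ((p : P) → Finset (Fin (n p))) :=
  Fintype.piFinset fun p => Finset.univ.powersetCard (m p)

lemma mem_allConnectors {k : (p : P) → Finset (Fin (n p))} :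
    k ∈ allConnectors n m ↔ ∀ p, (k p).card = m p := by
  simp [allConnectors]

lemma card_allConnectors (n m : P → ℕ) :
    (allConnectors n m).card = ∏ q, (n q).choose (m q) := by
  simp [allConnectors]

lemma map_connectorPerm_allConnectors (φ : (p : P) → Equiv.Perm (Fin (n p))) :
    (allConnectors n m).map (connectorPerm φ).toEmbedding = allConnectors n m := by
  refine Finset.eq_of_subset_of_card_le (fun x hx => ?_) (by simp)
  obtain ⟨y, hy, rfl⟩ := Finset.mem_map.1 hx
  rw [mem_allConnectors] at hy ⊢
  intro p
  simpa [connectorPerm_apply] using hy p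

namespace Conforms

variable {γ : Finset ((p : P) → Finset (Fin (n p)))}

lemma mul_eq (h : Conforms n m d γ) (p : P) : n p * d p = m p * γ.card := by
  rw [← sum_card_filter_mem h.2.1 p]
  simp [h.2.2 p]

lemma le (h : Conforms n m d γ) (p : P) : m p ≤ n p := by
  obtain ⟨k, hk⟩ := h.1
  simpa [h.2.1 k hk p] using Finset.card_le_univ (k p)

lemma subset_allConnectors (h : Conforms n m d γ) : γ ⊆ allConnectors n m :=
  fun k hk => mem_allConnectors.2 (h.2.1 k hk)

lemma map_connectorPerm (h : Conforms n m d γ) (φ : (p : P) → Equiv.Perm (Fin (n p))) :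
    Conforms n m d (γ.map (connectorPerm φ).toEmbedding) := by
  refine ⟨h.1.map, fun k hk p => ?_, fun p i => ?_⟩
  · obtain ⟨k', hk', rfl⟩ := Finset.mem_map.1 hk
    simpa [connectorPerm_apply] using h.2.1 k' hk' p
  · rw [card_filter_map_connectorPerm, h.2.2]

lemma eq_allConnectors_of_unique (h : Conforms n m d γ)
    (huniq : ∀ γ', Conforms n m d γ' → γ' = γ) : γ = allConnectors n m := by
  refine h.subset_allConnectors.antisymm fun k' hk' => ?_
  obtain ⟨k, hk⟩ := h.1
  obtain ⟨φ, rfl⟩ := exists_connectorPerm_eq (k := k) (k' := k')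
    fun p => (h.2.1 k hk p).trans (mem_allConnectors.1 hk' p).symm
  rw [← huniq _ (h.map_connectorPerm φ)]
  exact Finset.mem_map_of_mem _ hk

lemma eq_allConnectors (h : Conforms n m d γ) (hm : ∀ p, 0 < m p)
    (hd : ∀ p, n p * d p = m p * ∏ q, (n q).choose (m q)) : γ = allConnectors n m := by
  refine Finset.eq_of_subset_of_card_le h.subset_allConnectors ?_
  rcases isEmpty_or_nonempty P with hP | ⟨⟨p⟩⟩
  · simpa [card_allConnectors, Nat.one_le_iff_ne_zero] using h.1.ne_empty
  · rw [card_allConnectors]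
    exact (Nat.eq_of_mul_eq_mul_left (hm p) ((hd p).symm.trans (h.mul_eq p))).le

end Conforms

lemma conforms_allConnectors (hm : ∀ p, 0 < m p) (hmn : ∀ p, m p ≤ n p)
    (hd : ∀ p, n p * d p = m p * ∏ q, (n q).choose (m q)) :
    Conforms n m d (allConnectors n m) := by
  refine ⟨?_, fun k hk => mem_allConnectors.1 hk, fun p i => ?_⟩
  · rw [← Finset.card_pos, card_allConnectors]
    exact Finset.prod_pos fun q _ => Nat.choose_pos (hmn q)
  · have hconst (j : Fin (n p)) : ((allConnectors n m).filter fun k => j ∈ k p).card =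
        ((allConnectors n m).filter fun k => i ∈ k p).card := by
      have h := card_filter_map_connectorPerm
        (Function.update (fun _ => 1) p (Equiv.swap i j)) (allConnectors n m) p i
      rw [map_connectorPerm_allConnectors] at h
      simpa using h.symm
    have hsum := sum_card_filter_mem (γ := allConnectors n m)
      (fun k hk => mem_allConnectors.1 hk) p
    simp only [hconst, Finset.sum_const, Finset.card_univ, Fintype.card_fin, smul_eq_mul,
      card_allConnectors, ← hd p] at hsum
    exact Nat.eq_of_mul_eq_mul_left ((hm p).trans_le (hmn p)) hsum

end

theorem stmt_13 {L : Type*} [Fintype L] (P : L → Type*)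
    [∀ l, Fintype (P l)] [∀ l, DecidableEq (P l)]
    (n m d : (l : L) → P l → ℕ) (hm : ∀ l p, 0 < m l p) :
    (∃! A : (l : L) → Finset ((p : P l) → Finset (Fin (n l p))),
        ∀ l : L, Conforms (n l) (m l) (d l) (A l)) ↔
      ∀ (l : L) (p : P l), m l p ≤ n l p ∧
        n l p * d l p = m l p * ∏ q : P l, (n l q).choose (m l q) := by
  constructor
  · rintro ⟨A, hA, huniq⟩ l p
    refine ⟨(hA l).le p, ?_⟩
    have hfull : A l = allConnectors (n l) (m l) := by
      refine (hA l).eq_allConnectors_of_unique fun γ' hγ' => ?_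
      classical
      have h := huniq (Function.update A l γ') fun l' => by
        rcases eq_or_ne l' l with rfl | hl
        · simpa using hγ'
        · simpa [hl] using hA l'
      simpa using congrFun h l
    rw [(hA l).mul_eq p, hfull, card_allConnectors]
  · intro h
    exact ⟨fun l => allConnectors (n l) (m l),
      fun l => conforms_allConnectors (hm l) (fun p => (h l p).1) fun p => (h l p).2,
      fun A hA => funext fun l => (hA l).eq_allConnectors (hm l) fun p => (h l p).2⟩
end
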